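/- Let (T_n(t))_{t>0}, n ∈ ℕ, be a sequence of sub-Markovian semigroups of kernel operators on a Polish space E, increasing in n (T_n(t) ≤ T_{n+1}(t) for all n and t > 0), each enjoying the strong Feller property, with Laplace transforms (R_n(λ))_{λ>0}. Let (T(t))_{t>0} be the limit semigroup given by (T(t)f)(x) = lim_{n→∞}(T_n(t)f)(x), with Laplace transform (R(λ))_{λ>0}, and assume that R(λ₀)𝟙 is continuous for some λ₀ > 0. Assume further there exists a sequence (K_m)_{m∈ℕ} of compact subsets of E with ⋃_{m∈ℕ} K_m = E such that for every m and every x ∈ K_m one has (T_m(t)𝟙)(x) → 1 as t → 0+. Then for u, f ∈ C_b(E) the following are equivalent: (i) R(1)(u − f) = u; (ii) there exist sequences (u_n)_{n∈ℕ} and (f_n)_{n∈ℕ} in C_b(E) with R_n(1)(u_n − f_n) = u_n for every n, sup_{n∈ℕ}(‖u_n‖_∞ + ‖f_n‖_∞) < ∞, and u_n(x) → u(x), f_n(x) → f(x) for every x ∈ E; (iii) there exist sequences (u_n)_{n∈ℕ} and (f_n)_{n∈ℕ} in C_b(E) with R_n(1)(u_n − f_n) = u_n for every n, uniformly bounded in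 supremum norm, that converge to u and f, respectively, uniformly on every compact subset of E. -/

import Mathlib

open MeasureTheory Filter Topology

/-- `f` is a bounded Borel measurable real-valued function. -/
def IsBb {E : Type*} [MeasurableSpace E] (f : E → ℝ) : Prop :=
  Measurable f ∧ ∃ C : ℝ, ∀ x, |f x| ≤ C

/-- `f` is a bounded continuous real-valued function. -/
def IsCb {E : Type*} [TopologicalSpace E] (f : E → ℝ) : Prop :=
  Continuous f ∧ ∃ C : ℝ, ∀ x, |f x| ≤ C

/-- The kernel operator associated with a kernel `k : E → Measure E`. -/
noncomputable def kOp {E : Type*} [MeasurableSpace E] (k : E → Measure E) (f : E → ℝ) (x : E) : ℝ :=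
  ∫ y, f y ∂(k x)

/-- `(k t)_{t>0}` is a positive semigroup of kernels on `E`, bounded by `M`:
measurability in `x`, total mass bounded by `M`, Chapman–Kolmogorov, and joint
measurability of `(t,x) ↦ (T(t)f)(x)` on `(0,∞) × E` for bounded measurable `f`. -/
def IsKernelSemigroup {E : Type*} [MeasurableSpace E] (k : ℝ → E → Measure E) (M : NNReal) : Prop :=
  (∀ t, 0 < t → ∀ A : Set E, MeasurableSet A → Measurable fun x => k t x A) ∧
  (∀ t, 0 < t → ∀ x, k t x Set.univ ≤ (M : ENNReal)) ∧
  (∀ t, 0 < t → ∀ s, 0 < s → ∀ x, ∀ A : Set E, MeasurableSet A →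
    k (t + s) x A = ∫⁻ y, k s y A ∂(k t x)) ∧
  (∀ f : E → ℝ, IsBb f → Measurable fun p : Set.Ioi (0:ℝ) × E => kOp (k p.1.1) f p.2)

/-- The Laplace transform (pseudo-resolvent) of the semigroup of kernel operators. -/
noncomputable def laplaceOp {E : Type*} [MeasurableSpace E]
    (k : ℝ → E → Measure E) (l : ℝ) (f : E → ℝ) (x : E) : ℝ :=
  ∫ t in Set.Ioi (0:ℝ), Real.exp (-l * t) * kOp (k t) f x
lemma IsCb.isBb {E : Type*} [TopologicalSpace E] [MeasurableSpace E] [BorelSpace E]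
    {f : E → ℝ} (hf : IsCb f) : IsBb f :=
  ⟨hf.1.measurable, hf.2⟩

lemma IsCb.sub {E : Type*} [TopologicalSpace E] {f g : E → ℝ} (hf : IsCb f) (hg : IsCb g) :
    IsCb fun x => f x - g x := by
  obtain ⟨C, hC⟩ := hf.2
  obtain ⟨D, hD⟩ := hg.2
  exact ⟨hf.1.sub hg.1, C + D, fun x => (abs_sub _ _).trans (add_le_add (hC x) (hD x))⟩

lemma isBb_const {E : Type*} [MeasurableSpace E] (c : ℝ) : IsBb fun _ : E => c :=
  ⟨measurable_const, |c|, fun _ => le_rfl⟩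

lemma IsBb.integrable {E : Type*} [MeasurableSpace E] {f : E → ℝ} (hf : IsBb f)
    (μ : Measure E) [IsFiniteMeasure μ] : Integrable f μ := by
  obtain ⟨C, hC⟩ := hf.2
  exact Integrable.of_bound hf.1.aestronglyMeasurable C (Eventually.of_forall hC)

/-- The difference of the integrals of a function bounded by `B` against two ordered finite
measures is controlled by `B` times the difference of the total masses. -/
lemma abs_integral_sub_integral_le {E : Type*} [MeasurableSpace E] {μ ν : Measure E}
    [IsFiniteMeasure μ] [IsFiniteMeasure ν] (h : μ ≤ ν) {f : E → ℝ} (hf : Measurable f) {B : ℝ}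
    (hB : ∀ x, |f x| ≤ B) :
    |∫ y, f y ∂ν - ∫ y, f y ∂μ| ≤ B * (∫ _, (1 : ℝ) ∂ν - ∫ _, (1 : ℝ) ∂μ) := by
  have hfb : IsBb f := ⟨hf, B, hB⟩
  have h1 : ∫ y, (B - f y) ∂μ ≤ ∫ y, (B - f y) ∂ν :=
    integral_mono_measure h (Eventually.of_forall fun x => sub_nonneg.2 (abs_le.1 (hB x)).2)
      ((integrable_const B).sub (hfb.integrable ν))
  have h2 : ∫ y, (B + f y) ∂μ ≤ ∫ y, (B + f y) ∂ν :=
    integral_mono_measure h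
      (Eventually.of_forall fun x => by
        have := (abs_le.1 (hB x)).1
        simp only [Pi.zero_apply]
        linarith)
      ((integrable_const B).add (hfb.integrable ν))
  rw [integral_sub (integrable_const B) (hfb.integrable _),
    integral_sub (integrable_const B) (hfb.integrable _)] at h1
  rw [integral_add (integrable_const B) (hfb.integrable _),
    integral_add (integrable_const B) (hfb.integrable _)] at h2
  simp only [integral_const, smul_eq_mul, mul_one] at h1 h2 ⊢
  rw [abs_le]
  constructor <;> linarith

namespace IsKernelSemigroup

variable {E : Type*} [MeasurableSpace E] {k k' : ℝ → E → Measure E}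

lemma isFiniteMeasure {M : NNReal} (hk : IsKernelSemigroup k M) {t : ℝ} (ht : 0 < t) (x : E) :
    IsFiniteMeasure (k t x) :=
  ⟨(hk.2.1 t ht x).trans_lt ENNReal.coe_lt_top⟩

lemma abs_kOp_le (hk : IsKernelSemigroup k 1) {t : ℝ} (ht : 0 < t) {f : E → ℝ} {C : ℝ}
    (hf : ∀ x, |f x| ≤ C) (x : E) : |kOp (k t) f x| ≤ C := by
  have := hk.isFiniteMeasure ht x
  have hC : 0 ≤ C := (abs_nonneg _).trans (hf x)
  have h1 : (k t x).real Set.univ ≤ 1 := by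
    have := ENNReal.toReal_mono ENNReal.coe_ne_top (hk.2.1 t ht x)
    simpa [Measure.real] using this
  calc |kOp (k t) f x| ≤ C * (k t x).real Set.univ := by
        rw [← Real.norm_eq_abs, kOp]
        exact norm_integral_le_of_norm_le_const (Eventually.of_forall hf)
    _ ≤ C := mul_le_of_le_one_right hC h1

lemma aestronglyMeasurable_kOp {M : NNReal} (hk : IsKernelSemigroup k M) {f : E → ℝ}
    (hf : IsBb f) (l : ℝ) (x : E) :
    AEStronglyMeasurable (fun t => Real.exp (-l * t) * kOp (k t) f x)
      (volume.restrict (Set.Ioi 0)) := by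
  refine AEStronglyMeasurable.mul (by fun_prop) (AEMeasurable.aestronglyMeasurable ?_)
  refine aemeasurable_restrict_of_measurable_subtype measurableSet_Ioi ?_
  exact (hk.2.2.2 f hf).comp (measurable_id.prodMk measurable_const)

lemma norm_exp_mul_kOp_le (hk : IsKernelSemigroup k 1) {f : E → ℝ} {C : ℝ}
    (hf : ∀ x, |f x| ≤ C) (l : ℝ) (x : E) :
    ∀ᵐ t ∂(volume.restrict (Set.Ioi (0 : ℝ))),
      ‖Real.exp (-l * t) * kOp (k t) f x‖ ≤ Real.exp (-l * t) * C := by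
  filter_upwards [ae_restrict_mem measurableSet_Ioi] with t ht
  rw [norm_mul, Real.norm_eq_abs, Real.abs_exp]
  exact mul_le_mul_of_nonneg_left (hk.abs_kOp_le ht hf x) (Real.exp_pos _).le

lemma integrable_exp_mul_kOp (hk : IsKernelSemigroup k 1) {f : E → ℝ} (hf : IsBb f)
    {l : ℝ} (hl : 0 < l) (x : E) :
    Integrable (fun t => Real.exp (-l * t) * kOp (k t) f x) (volume.restrict (Set.Ioi 0)) := by
  obtain ⟨C, hC⟩ := hf.2
  exact ((exp_neg_integrableOn_Ioi 0 hl).mul_const C).mono'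
    (hk.aestronglyMeasurable_kOp hf l x) (hk.norm_exp_mul_kOp_le hC l x)

lemma abs_laplaceOp_le (hk : IsKernelSemigroup k 1) {f : E → ℝ} {C : ℝ}
    (hC : ∀ x, |f x| ≤ C) {l : ℝ} (hl : 0 < l) (x : E) : |laplaceOp k l f x| ≤ C / l := by
  refine (norm_integral_le_of_norm_le ((exp_neg_integrableOn_Ioi 0 hl).mul_const C)
    (hk.norm_exp_mul_kOp_le hC l x)).trans_eq ?_
  rw [integral_mul_const, integral_exp_mul_Ioi (neg_lt_zero.2 hl)]
  simp
  field_simp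

/-- The Laplace transform of a strong Feller semigroup is strong Feller. -/
lemma continuous_laplaceOp [TopologicalSpace E] [FirstCountableTopology E]
    (hk : IsKernelSemigroup k 1) {f : E → ℝ} (hf : IsBb f)
    (hcont : ∀ t, 0 < t → Continuous (kOp (k t) f)) {l : ℝ} (hl : 0 < l) :
    Continuous (laplaceOp k l f) := by
  obtain ⟨C, hC⟩ := hf.2
  refine continuous_of_dominated (fun x => hk.aestronglyMeasurable_kOp hf l x)
    (fun x => hk.norm_exp_mul_kOp_le hC l x) ((exp_neg_integrableOn_Ioi 0 hl).mul_const C) ?_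
  filter_upwards [ae_restrict_mem measurableSet_Ioi] with t ht
  exact continuous_const.mul (hcont t ht)

lemma tendsto_kOp {M : NNReal} (hk : IsKernelSemigroup k M) {g : ℕ → E → ℝ} {f : E → ℝ} {C : ℝ}
    (hg : ∀ n, Measurable (g n)) (hC : ∀ n x, |g n x| ≤ C)
    (h : ∀ x, Tendsto (fun n => g n x) atTop (𝓝 (f x))) {t : ℝ} (ht : 0 < t) (x : E) :
    Tendsto (fun n => kOp (k t) (g n) x) atTop (𝓝 (kOp (k t) f x)) := by
  have := hk.isFiniteMeasure ht x
  exact tendsto_integral_of_dominated_convergence (fun _ => C)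
    (fun n => (hg n).aestronglyMeasurable) (integrable_const C)
    (fun n => Eventually.of_forall (hC n)) (Eventually.of_forall h)

end IsKernelSemigroup

/-- Laplace transforms of sub-Markovian semigroups pass to pointwise limits of
`(T_n(t) g_n)(x)` for uniformly bounded `g_n`. -/
lemma tendsto_laplaceOp {E : Type*} [MeasurableSpace E] {k : ℕ → ℝ → E → Measure E}
    {k' : ℝ → E → Measure E} (hk : ∀ n, IsKernelSemigroup (k n) 1)
    {g : ℕ → E → ℝ} {f : E → ℝ} {C : ℝ}
    (hg : ∀ n, Measurable (g n)) (hC : ∀ n x, |g n x| ≤ C) {x : E}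
    (h : ∀ t, 0 < t → Tendsto (fun n => kOp (k n t) (g n) x) atTop (𝓝 (kOp (k' t) f x)))
    {l : ℝ} (hl : 0 < l) :
    Tendsto (fun n => laplaceOp (k n) l (g n) x) atTop (𝓝 (laplaceOp k' l f x)) := by
  refine tendsto_integral_of_dominated_convergence (fun t => Real.exp (-l * t) * C)
    (fun n => (hk n).aestronglyMeasurable_kOp ⟨hg n, C, hC n⟩ l x)
    ((exp_neg_integrableOn_Ioi 0 hl).mul_const C)
    (fun n => (hk n).norm_exp_mul_kOp_le (hC n) l x) ?_
  filter_upwards [ae_restrict_mem measurableSet_Ioi] with t ht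
  exact (h t ht).const_mul _

lemma laplaceOp_mono {E : Type*} [MeasurableSpace E] {k k' : ℝ → E → Measure E}
    (hk : IsKernelSemigroup k 1) (hk' : IsKernelSemigroup k' 1)
    (hle : ∀ t, 0 < t → ∀ x, k t x ≤ k' t x) {f : E → ℝ} (hf : IsBb f) (hf0 : ∀ x, 0 ≤ f x)
    {l : ℝ} (hl : 0 < l) (x : E) : laplaceOp k l f x ≤ laplaceOp k' l f x := by
  refine integral_mono_ae (hk.integrable_exp_mul_kOp hf hl x)
    (hk'.integrable_exp_mul_kOp hf hl x) ?_
  filter_upwards [ae_restrict_mem measurableSet_Ioi] with t ht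
  have := hk'.isFiniteMeasure ht x
  exact mul_le_mul_of_nonneg_left
    (integral_mono_measure (hle t ht x) (Eventually.of_forall hf0) (hf.integrable _))
    (Real.exp_pos _).le

lemma exp_neg_le_exp_mul_add {l S t : ℝ} (hl : 0 < l) (ht : 0 < t) :
    Real.exp (-1 * t) ≤ Real.exp (l * S) * Real.exp (-l * t)
      + Real.exp (-(S / 2)) * Real.exp (-(1 / 2) * t) := by
  rw [← Real.exp_add, ← Real.exp_add]
  rcases le_total t S with h | h
  · have : Real.exp (-1 * t) ≤ Real.exp (l * S + -l * t) := by
      apply Real.exp_le_exp.2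
      nlinarith
    linarith [Real.exp_pos (-(S / 2) + -(1 / 2) * t)]
  · have : Real.exp (-1 * t) ≤ Real.exp (-(S / 2) + -(1 / 2) * t) := by
      apply Real.exp_le_exp.2
      linarith
    linarith [Real.exp_pos (l * S + -l * t)]

/-- For ordered sub-Markovian semigroups, the difference of the Laplace transforms at `1` is
controlled, uniformly over functions bounded by `B`, by the difference of the Laplace transforms
of the constant function `1` at an arbitrary `l > 0`, up to a small error. -/
lemma abs_laplaceOp_sub_le {E : Type*} [MeasurableSpace E] {k k' : ℝ → E → Measure E}
    (hk : IsKernelSemigroup k 1) (hk' : IsKernelSemigroup k' 1)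
    (hle : ∀ t, 0 < t → ∀ x, k t x ≤ k' t x) {f : E → ℝ} (hf : Measurable f) {B : ℝ}
    (hB : ∀ x, |f x| ≤ B) {l : ℝ} (hl : 0 < l) (S : ℝ) (x : E) :
    |laplaceOp k' 1 f x - laplaceOp k 1 f x| ≤
      B * (Real.exp (l * S) * (laplaceOp k' l (fun _ => 1) x - laplaceOp k l (fun _ => 1) x)
        + Real.exp (-(S / 2)) * 4) := by
  have hB0 : 0 ≤ B := (abs_nonneg _).trans (hB x)
  have hfb : IsBb f := ⟨hf, B, hB⟩
  have h1 : IsBb fun _ : E => (1 : ℝ) := isBb_const 1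
  have hhalf : (0 : ℝ) < 1 / 2 := by norm_num
  have hD : ∀ {m : ℝ}, 0 < m → Integrable (fun t => Real.exp (-m * t) * kOp (k' t) (fun _ => 1) x
      - Real.exp (-m * t) * kOp (k t) (fun _ => 1) x) (volume.restrict (Set.Ioi 0)) := fun hm =>
    (hk'.integrable_exp_mul_kOp h1 hm x).sub (hk.integrable_exp_mul_kOp h1 hm x)
  have hmain : |laplaceOp k' 1 f x - laplaceOp k 1 f x| ≤
      B * (Real.exp (l * S) * (laplaceOp k' l (fun _ => 1) x - laplaceOp k l (fun _ => 1) x)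
        + Real.exp (-(S / 2)) *
          (laplaceOp k' (1 / 2) (fun _ => 1) x - laplaceOp k (1 / 2) (fun _ => 1) x)) := by
    simp only [laplaceOp]
    rw [← integral_sub (hk'.integrable_exp_mul_kOp hfb one_pos x)
        (hk.integrable_exp_mul_kOp hfb one_pos x),
      ← integral_sub (hk'.integrable_exp_mul_kOp h1 hl x) (hk.integrable_exp_mul_kOp h1 hl x),
      ← integral_sub (hk'.integrable_exp_mul_kOp h1 hhalf x)
        (hk.integrable_exp_mul_kOp h1 hhalf x),
      ← integral_const_mul, ← integral_const_mul,
      ← integral_add ((hD hl).const_mul _) ((hD hhalf).const_mul _), ← integral_const_mul, ← Real.norm_eq_abs]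
    refine norm_integral_le_of_norm_le
      ((((hD hl).const_mul _).add ((hD hhalf).const_mul _)).const_mul _) ?_
    filter_upwards [ae_restrict_mem measurableSet_Ioi] with t ht
    have := hk.isFiniteMeasure ht x
    have := hk'.isFiniteMeasure ht x
    have hd := abs_integral_sub_integral_le (hle t ht x) hf hB
    have hd0 : 0 ≤ B * (kOp (k' t) (fun _ => 1) x - kOp (k t) (fun _ => 1) x) :=
      (abs_nonneg _).trans hd
    rw [← mul_sub, norm_mul, Real.norm_eq_abs, Real.abs_exp, Real.norm_eq_abs]
    calc Real.exp (-1 * t) * |kOp (k' t) f x - kOp (k t) f x|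
        ≤ Real.exp (-1 * t) * (B * (kOp (k' t) (fun _ => 1) x - kOp (k t) (fun _ => 1) x)) :=
          mul_le_mul_of_nonneg_left hd (Real.exp_pos _).le
      _ ≤ (Real.exp (l * S) * Real.exp (-l * t)
            + Real.exp (-(S / 2)) * Real.exp (-(1 / 2) * t)) *
            (B * (kOp (k' t) (fun _ => 1) x - kOp (k t) (fun _ => 1) x)) :=
          mul_le_mul_of_nonneg_right (exp_neg_le_exp_mul_add hl ht) hd0
      _ = _ := by ring
  refine hmain.trans (mul_le_mul_of_nonneg_left ?_ hB0)
  have hb' := abs_le.1 (hk'.abs_laplaceOp_le (f := fun _ => 1) (C := 1) (by simp) hhalf x)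
  have hb := abs_le.1 (hk.abs_laplaceOp_le (f := fun _ => 1) (C := 1) (by simp) hhalf x)
  gcongr
  linarith [hb'.2, hb.1]

/-- A pointwise limit of an increasing sequence of kernels dominates each of its terms. -/
lemma kernel_le_of_tendsto {E : Type*} [MeasurableSpace E] {k : ℕ → E → Measure E}
    {k' : E → Measure E} {x : E} (hmono : Monotone fun n => k n x)
    (hfin : ∀ n, IsFiniteMeasure (k n x)) [IsFiniteMeasure (k' x)]
    (hlim : ∀ f : E → ℝ, IsBb f → Tendsto (fun n => kOp (k n) f x) atTop (𝓝 (kOp k' f x)))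
    (n : ℕ) : k n x ≤ k' x := by
  refine Measure.le_iff.2 fun A hA => ?_
  have hb : IsBb (A.indicator fun _ => (1 : ℝ)) := by
    refine ⟨measurable_const.indicator hA, 1, fun y => ?_⟩
    by_cases hy : y ∈ A <;> simp [hy]
  have h := hlim _ hb
  simp only [kOp, integral_indicator hA, setIntegral_const, smul_eq_mul, mul_one] at h
  have hreal : (k n x).real A ≤ (k' x).real A := by
    refine ge_of_tendsto h (eventually_atTop.2 ⟨n, fun m hm => ?_⟩)
    have := hfin m
    exact ENNReal.toReal_mono (measure_ne_top _ _) (hmono hm A)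
  have := hfin n
  exact (ENNReal.toReal_le_toReal (measure_ne_top _ _) (measure_ne_top _ _)).1 hreal

/-- For an increasing sequence of strong Feller sub-Markovian semigroups whose limit has a
continuous Laplace transform of `1` at some `l > 0`, the Laplace transforms at `1` converge
uniformly on compact sets and uniformly over functions bounded by `B`. -/
lemma eventually_abs_laplaceOp_sub_lt {E : Type*} [TopologicalSpace E] [FirstCountableTopology E]
    [MeasurableSpace E] {k : ℕ → ℝ → E → Measure E} {k' : ℝ → E → Measure E}
    (hk : ∀ n, IsKernelSemigroup (k n) 1) (hk' : IsKernelSemigroup k' 1)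
    (hmono : ∀ t, 0 < t → ∀ x, Monotone fun n => k n t x)
    (hsf : ∀ n, ∀ t, 0 < t → Continuous (kOp (k n t) fun _ => (1 : ℝ)))
    (hlim : ∀ f : E → ℝ, IsBb f → ∀ t, 0 < t → ∀ x,
      Tendsto (fun n => kOp (k n t) f x) atTop (𝓝 (kOp (k' t) f x)))
    {l : ℝ} (hl : 0 < l) (hcont : Continuous (laplaceOp k' l fun _ => (1 : ℝ)))
    {s : Set E} (hs : IsCompact s) {B : ℝ} (hB : 0 ≤ B) {ε : ℝ} (hε : 0 < ε) :
    ∀ᶠ n in atTop, ∀ x ∈ s, ∀ f : E → ℝ, Measurable f → (∀ y, |f y| ≤ B) →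
      |laplaceOp k' 1 f x - laplaceOp (k n) 1 f x| < ε := by
  have h1 : IsBb fun _ : E => (1 : ℝ) := isBb_const 1
  have hle : ∀ n t, 0 < t → ∀ x, k n t x ≤ k' t x := fun n t ht x => by
    have := hk'.isFiniteMeasure ht x
    exact kernel_le_of_tendsto (hmono t ht x) (fun m => (hk m).isFiniteMeasure ht x)
      (fun f hf => hlim f hf t ht x) n
  have hdini : TendstoUniformlyOn (fun n => laplaceOp (k n) l fun _ => (1 : ℝ))
      (laplaceOp k' l fun _ => (1 : ℝ)) atTop s := by
    refine Monotone.tendstoUniformlyOn_of_forall_tendsto hs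
      (fun n => ((hk n).continuous_laplaceOp h1 (hsf n) hl).continuousOn) ?_
      hcont.continuousOn ?_
    · intro x _ n m hnm
      exact laplaceOp_mono (hk n) (hk m) (fun t ht y => hmono t ht y hnm) h1
        (fun _ => zero_le_one) hl x
    · intro x _
      exact tendsto_laplaceOp hk (g := fun _ _ => 1) (C := 1) (fun _ => measurable_const)
        (by simp) (fun t ht => hlim _ h1 t ht x) hl
  obtain ⟨S, hS⟩ : ∃ S : ℝ, B * (Real.exp (-(S / 2)) * 4) < ε / 2 := by
    have h : Tendsto (fun S : ℝ => B * (Real.exp (-(S / 2)) * 4)) atTop (𝓝 (B * (0 * 4))) := by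
      refine ((Real.tendsto_exp_atBot.comp ?_).mul_const 4).const_mul B
      exact tendsto_neg_atTop_atBot.comp (tendsto_id.atTop_div_const two_pos)
    have h' := h.eventually (gt_mem_nhds (show B * (0 * 4) < ε / 2 by simpa using half_pos hε))
    exact h'.exists
  have hpos : 0 < B * Real.exp (l * S) + 1 := by positivity
  have hδ : 0 < ε / 2 / (B * Real.exp (l * S) + 1) := by positivity
  filter_upwards [Metric.tendstoUniformlyOn_iff.1 hdini _ hδ] with n hn x hx f hf hfB
  have hd := (le_abs_self _).trans_lt (hn x hx)
  have hd0 := sub_nonneg.2 (laplaceOp_mono (hk n) hk' (hle n) h1 (fun _ => zero_le_one) hl x)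
  rw [lt_div_iff₀ hpos] at hd
  have := abs_laplaceOp_sub_le (hk n) hk' (hle n) hf hfB hl S x
  nlinarith

/-- Characterisation of the `C_b`-generator of the limit semigroup: for
`u, f ∈ C_b(E)`, the pair `(u,f)` belongs to the generator (i.e. `R(1)(u-f) = u`)
iff there are uniformly bounded pairs `(u_n, f_n)` in the generators of the
approximating semigroups converging pointwise (equivalently, uniformly on compact
sets) to `(u,f)`. -/
theorem cb_generator_of_limit_semigroup
    {E : Type*} [TopologicalSpace E] [PolishSpace E] [MeasurableSpace E] [BorelSpace E]
    (kseq : ℕ → ℝ → E → Measure E) (klim : ℝ → E → Measure E)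
    (hsg : ∀ n, IsKernelSemigroup (kseq n) 1)
    (hmono : ∀ n, ∀ t, 0 < t → ∀ x, ∀ A : Set E, MeasurableSet A →
      kseq n t x A ≤ kseq (n + 1) t x A)
    (hsf : ∀ n, ∀ t, 0 < t → ∀ f : E → ℝ, IsBb f → IsCb (kOp (kseq n t) f))
    (hlimsg : IsKernelSemigroup klim 1)
    (hlim : ∀ f : E → ℝ, IsBb f → ∀ t, 0 < t → ∀ x,
      Tendsto (fun n => kOp (kseq n t) f x) atTop (𝓝 (kOp (klim t) f x)))
    (hB : ∃ l : ℝ, 0 < l ∧ Continuous (laplaceOp klim l (fun _ => (1 : ℝ))))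
    (K : ℕ → Set E) (hKcomp : ∀ m, IsCompact (K m)) (hKcover : (⋃ m, K m) = Set.univ)
    (hKone : ∀ m, ∀ x ∈ K m,
      Tendsto (fun t => kOp (kseq m t) (fun _ => (1 : ℝ)) x) (𝓝[>] (0 : ℝ)) (𝓝 1))
    (u f : E → ℝ) (hu : IsCb u) (hf : IsCb f) :
    ((∀ x, laplaceOp klim 1 (fun y => u y - f y) x = u x) ↔
      (∃ useq fseq : ℕ → E → ℝ,
        (∀ n, IsCb (useq n) ∧ IsCb (fseq n)) ∧
        (∀ n, ∀ x, laplaceOp (kseq n) 1 (fun y => useq n y - fseq n y) x = useq n x) ∧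
        (∃ C : ℝ, ∀ n, ∀ x, |useq n x| ≤ C ∧ |fseq n x| ≤ C) ∧
        (∀ x, Tendsto (fun n => useq n x) atTop (𝓝 (u x))) ∧
        (∀ x, Tendsto (fun n => fseq n x) atTop (𝓝 (f x))))) ∧
    ((∀ x, laplaceOp klim 1 (fun y => u y - f y) x = u x) ↔
      (∃ useq fseq : ℕ → E → ℝ,
        (∀ n, IsCb (useq n) ∧ IsCb (fseq n)) ∧
        (∀ n, ∀ x, laplaceOp (kseq n) 1 (fun y => useq n y - fseq n y) x = useq n x) ∧
        (∃ C : ℝ, ∀ n, ∀ x, |useq n x| ≤ C ∧ |fseq n x| ≤ C) ∧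
        (∀ C : Set E, IsCompact C → TendstoUniformlyOn (fun n x => useq n x) u atTop C) ∧
        (∀ C : Set E, IsCompact C → TendstoUniformlyOn (fun n x => fseq n x) f atTop C))) := by
  obtain ⟨l, hl, hlc⟩ := hB
  have hmono' : ∀ t, 0 < t → ∀ x, Monotone fun n => kseq n t x := fun t ht x =>
    monotone_nat_of_le_succ fun n => Measure.le_iff.2 fun A hA => hmono n t ht x A hA
  have hunif := fun {s : Set E} (hs : IsCompact s) {B : ℝ} (hB : 0 ≤ B) {ε : ℝ} (hε : 0 < ε) =>
    eventually_abs_laplaceOp_sub_lt hsg hlimsg hmono'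
      (fun n t ht => (hsf n t ht _ (isBb_const 1)).1) hlim hl hlc hs hB hε
  have hcompact : (∀ x, laplaceOp klim 1 (fun y => u y - f y) x = u x) →
      ∃ useq fseq : ℕ → E → ℝ,
        (∀ n, IsCb (useq n) ∧ IsCb (fseq n)) ∧
        (∀ n, ∀ x, laplaceOp (kseq n) 1 (fun y => useq n y - fseq n y) x = useq n x) ∧
        (∃ C : ℝ, ∀ n, ∀ x, |useq n x| ≤ C ∧ |fseq n x| ≤ C) ∧
        (∀ C : Set E, IsCompact C → TendstoUniformlyOn (fun n x => useq n x) u atTop C) ∧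
        (∀ C : Set E, IsCompact C → TendstoUniformlyOn (fun n x => fseq n x) f atTop C) := by
    intro h
    have hg : IsCb fun y => u y - f y := hu.sub hf
    obtain ⟨B, hB⟩ := hg.2
    have hv : ∀ n, IsCb (laplaceOp (kseq n) 1 fun y => u y - f y) := fun n =>
      ⟨(hsg n).continuous_laplaceOp hg.isBb (fun t ht => (hsf n t ht _ hg.isBb).1) one_pos,
        B / 1, (hsg n).abs_laplaceOp_le hB one_pos⟩
    have hconv : ∀ s : Set E, IsCompact s → ∀ ε > 0, ∀ᶠ n in atTop, ∀ x ∈ s,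
        |u x - laplaceOp (kseq n) 1 (fun y => u y - f y) x| < ε := by
      intro s hs ε hε
      filter_upwards [hunif hs (abs_nonneg B) hε] with n hn x hx
      rw [← h x]
      exact hn x hx _ hg.isBb.1 fun y => (hB y).trans (le_abs_self B)
    refine ⟨fun n => laplaceOp (kseq n) 1 fun y => u y - f y,
      fun n x => laplaceOp (kseq n) 1 (fun y => u y - f y) x - (u x - f x),
      fun n => ⟨hv n, (hv n).sub hg⟩, fun n x => by simp only [sub_sub_cancel],
      ⟨B + B, fun n x => ?_⟩, fun s hs => ?_, fun s hs => ?_⟩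
    · have h1 := (hsg n).abs_laplaceOp_le hB one_pos x
      rw [div_one] at h1
      exact ⟨h1.trans (le_add_of_nonneg_left ((abs_nonneg _).trans (hB x))),
        (abs_sub _ _).trans (add_le_add h1 (hB x))⟩
    · exact Metric.tendstoUniformlyOn_iff.2 (hconv s hs)
    · refine Metric.tendstoUniformlyOn_iff.2 fun ε hε => ?_
      filter_upwards [hconv s hs ε hε] with n hn x hx
      rw [Real.dist_eq]
      convert hn x hx using 2
      ring
  have hpointwise : (∃ useq fseq : ℕ → E → ℝ,
        (∀ n, IsCb (useq n) ∧ IsCb (fseq n)) ∧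
        (∀ n, ∀ x, laplaceOp (kseq n) 1 (fun y => useq n y - fseq n y) x = useq n x) ∧
        (∃ C : ℝ, ∀ n, ∀ x, |useq n x| ≤ C ∧ |fseq n x| ≤ C) ∧
        (∀ x, Tendsto (fun n => useq n x) atTop (𝓝 (u x))) ∧
        (∀ x, Tendsto (fun n => fseq n x) atTop (𝓝 (f x)))) →
      ∀ x, laplaceOp klim 1 (fun y => u y - f y) x = u x := by
    rintro ⟨useq, fseq, hcb, hgen, ⟨C, hC⟩, hulim, hflim⟩ x
    have hmeas : ∀ n, Measurable fun y => useq n y - fseq n y := fun n =>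
      ((hcb n).1.sub (hcb n).2).isBb.1
    have hbd : ∀ n y, |useq n y - fseq n y| ≤ C + C := fun n y =>
      (abs_sub _ _).trans (add_le_add (hC n y).1 (hC n y).2)
    have h1 : Tendsto (fun n => laplaceOp klim 1 (fun y => useq n y - fseq n y) x) atTop
        (𝓝 (laplaceOp klim 1 (fun y => u y - f y) x)) :=
      tendsto_laplaceOp (fun _ => hlimsg) hmeas hbd
        (fun t ht => hlimsg.tendsto_kOp hmeas hbd (fun y => (hulim y).sub (hflim y)) ht x) one_pos
    have h2 : Tendsto (fun n => laplaceOp klim 1 (fun y => useq n y - fseq n y) x) atTop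
        (𝓝 (u x)) := by
      have h3 : Tendsto (fun n => laplaceOp klim 1 (fun y => useq n y - fseq n y) x - useq n x)
          atTop (𝓝 0) := by
        refine Metric.tendsto_nhds.2 fun ε hε => ?_
        filter_upwards [hunif (isCompact_singleton (x := x))
          ((abs_nonneg _).trans (hbd 0 x)) hε] with n hn
        rw [Real.dist_eq, sub_zero, ← hgen n x]
        exact hn x rfl _ (hmeas n) (hbd n)
      simpa using h3.add (hulim x)
    exact tendsto_nhds_unique h1 h2
  have hweaken : (∃ useq fseq : ℕ → E → ℝ,
        (∀ n, IsCb (useq n) ∧ IsCb (fseq n)) ∧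
        (∀ n, ∀ x, laplaceOp (kseq n) 1 (fun y => useq n y - fseq n y) x = useq n x) ∧
        (∃ C : ℝ, ∀ n, ∀ x, |useq n x| ≤ C ∧ |fseq n x| ≤ C) ∧
        (∀ C : Set E, IsCompact C → TendstoUniformlyOn (fun n x => useq n x) u atTop C) ∧
        (∀ C : Set E, IsCompact C → TendstoUniformlyOn (fun n x => fseq n x) f atTop C)) →
      ∃ useq fseq : ℕ → E → ℝ,
        (∀ n, IsCb (useq n) ∧ IsCb (fseq n)) ∧
        (∀ n, ∀ x, laplaceOp (kseq n) 1 (fun y => useq n y - fseq n y) x = useq n x) ∧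
        (∃ C : ℝ, ∀ n, ∀ x, |useq n x| ≤ C ∧ |fseq n x| ≤ C) ∧
        (∀ x, Tendsto (fun n => useq n x) atTop (𝓝 (u x))) ∧
        (∀ x, Tendsto (fun n => fseq n x) atTop (𝓝 (f x))) := by
    rintro ⟨useq, fseq, hcb, hgen, hC, hulim, hflim⟩
    exact ⟨useq, fseq, hcb, hgen, hC,
      fun x => (hulim {x} isCompact_singleton).tendsto_at rfl,
      fun x => (hflim {x} isCompact_singleton).tendsto_at rfl⟩
  exact ⟨⟨fun h => hweaken (hcompact h), hpointwise⟩,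
    ⟨hcompact, fun h => hpointwise (hweaken h)⟩⟩
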